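/- arXiv:1703.02134 — 2 statements merged into one kernel-verified Lean document; each statement's English description precedes it below -/
import Mathlib

section
/- (Upper bound for the curvature term on I_main.) In the travelling-frame setup, assume sup over r,t of |u_r(r,t)|²/2 ≤ B < ∞. Then for every s ≥ 0: ∫_{I_main(s)} χ(ρ,s) · ((d−1)/(r₀+cs+ρ))² · |v_ρ(ρ,s)|²/2 dρ ≤ B(d−1)² · ( e^{−c r₀/2} + (2/r₀) e^{c(x_cut + c_cut·s)} ). -/
open Filter Topology Set MeasureTheory

noncomputable section

local notation "⟪" x ", " y "⟫" => @inner ℝ _ _ x y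

abbrev Euc (n : ℕ) : Type := EuclideanSpace ℝ (Fin n)

variable {n : ℕ}

/-- Spatial partial derivative `u_r`. -/
def ur (u : ℝ → ℝ → Euc n) (r t : ℝ) : Euc n := deriv (fun s => u s t) r

/-- Second spatial partial derivative `u_rr`. -/
def urr (u : ℝ → ℝ → Euc n) (r t : ℝ) : Euc n := deriv (fun s => ur u s t) r

/-- Time partial derivative `u_t`. -/
def ut (u : ℝ → ℝ → Euc n) (r t : ℝ) : Euc n := deriv (fun s => u r s) t

/-- Hessian (second differential) of the potential. -/
def hess (V : Euc n → ℝ) (x : Euc n) : Euc n →L[ℝ] Euc n := fderiv ℝ (gradient V) x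

/-- Coercivity hypothesis. -/
def HCoerc (V : Euc n → ℝ) : Prop :=
  ∃ ε > (0:ℝ), ∃ R : ℝ, ∀ x : Euc n, R ≤ ‖x‖ → ε * ‖x‖ ^ 2 ≤ ⟪x, gradient V x⟫

/-- The set of nondegenerate minimum points of `V`. -/
def MinSet (V : Euc n → ℝ) : Set (Euc n) :=
  {m | gradient V m = 0 ∧ ∀ v : Euc n, v ≠ 0 → 0 < ⟪v, hess V m v⟫}

/-- Data of the constants `λ_min`, `λ_max`, `d_Esc` from the paper, together with their
spectral characterizations. -/
structure EscData (n : ℕ) (V : Euc n → ℝ) where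
  lmin : ℝ
  lmax : ℝ
  dEsc : ℝ
  lmin_pos : 0 < lmin
  dEsc_pos : 0 < dEsc
  lower : ∀ m ∈ MinSet V, ∀ v : Euc n, lmin * ‖v‖ ^ 2 ≤ ⟪v, hess V m v⟫
  upper : ∀ m ∈ MinSet V, ∀ v : Euc n, ⟪v, hess V m v⟫ ≤ lmax * ‖v‖ ^ 2
  esc_lower : ∀ m ∈ MinSet V, ∀ x : Euc n, ‖x - m‖ ≤ dEsc →
    ∀ v : Euc n, lmin / 2 * ‖v‖ ^ 2 ≤ ⟪v, hess V x v⟫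
  esc_upper : ∀ m ∈ MinSet V, ∀ x : Euc n, ‖x - m‖ ≤ dEsc →
    ∀ v : Euc n, ⟪v, hess V x v⟫ ≤ 2 * lmax * ‖v‖ ^ 2

/-- Radially symmetric solution of `u_t = -∇V(u) + ((d-1)/r) u_r + u_rr` with Neumann
boundary condition at the origin. -/
structure IsRadialSolution (d : ℕ) (V : Euc n → ℝ) (u : ℝ → ℝ → Euc n) : Prop where
  diff_r : ∀ t > (0:ℝ), ∀ r : ℝ, DifferentiableAt ℝ (fun s => u s t) r
  diff_rr : ∀ t > (0:ℝ), ∀ r : ℝ, DifferentiableAt ℝ (fun s => ur u s t) r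
  cont_rr : ∀ t > (0:ℝ), Continuous fun r => urr u r t
  diff_t : ∀ t > (0:ℝ), ∀ r : ℝ, DifferentiableAt ℝ (fun s => u r s) t
  cont_t : ∀ r : ℝ, ContinuousOn (fun s => ut u r s) (Ioi 0)
  bounded : ∃ C : ℝ, ∀ r t : ℝ, 0 ≤ r → 0 < t →
    ‖u r t‖ + ‖ur u r t‖ + ‖urr u r t‖ + ‖ut u r t‖ ≤ C
  pde : ∀ r > (0:ℝ), ∀ t > (0:ℝ),
    ut u r t = -gradient V (u r t) + (((d : ℝ) - 1) / r) • ur u r t + urr u r t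
  neumann : ∀ t > (0:ℝ), ur u 0 t = 0

/-- Profiles of fronts travelling at speed `c` connecting `um` to `up`
(nonconstant solutions of `φ'' = -cφ' + ∇V(φ)`). -/
def Phi (V : Euc n → ℝ) (c : ℝ) (um up : Euc n) : Set (ℝ → Euc n) :=
  {φ | (∃ ξ₁ ξ₂ : ℝ, φ ξ₁ ≠ φ ξ₂) ∧
    (∀ ξ : ℝ, DifferentiableAt ℝ φ ξ) ∧ (∀ ξ : ℝ, DifferentiableAt ℝ (deriv φ) ξ) ∧
    (∀ ξ : ℝ, deriv (deriv φ) ξ = -(c • deriv φ ξ) + gradient V (φ ξ)) ∧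
    Tendsto φ atBot (𝓝 um) ∧ Tendsto φ atTop (𝓝 up)}

/-- Fronts travelling at speed `c` invading the equilibrium `mp`. -/
def PhiInv (V : Euc n → ℝ) (c : ℝ) (mp : Euc n) : Set (ℝ → Euc n) :=
  ⋃ mm ∈ MinSet V, Phi V c mm mp

/-- Normalized front profiles. -/
def PhiNorm (V : Euc n → ℝ) (dEsc c : ℝ) (mm mp : Euc n) : Set (ℝ → Euc n) :=
  {φ | φ ∈ Phi V c mm mp ∧ ‖φ 0 - mp‖ = dEsc ∧ ∀ ξ > (0:ℝ), ‖φ ξ - mp‖ < dEsc}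

/-- Normalized front profiles invading `mp`. -/
def PhiNormInv (V : Euc n → ℝ) (dEsc c : ℝ) (mp : Euc n) : Set (ℝ → Euc n) :=
  ⋃ mm ∈ MinSet V, PhiNorm V dEsc c mm mp

/-- Every critical point of `V` is nondegenerate. -/
def HNonDeg (V : Euc n → ℝ) : Prop :=
  ∀ x : Euc n, gradient V x = 0 → ∀ v : Euc n, hess V x v = 0 → v = 0

/-- Every front travelling at a positive speed and invading a minimum point is bistable. -/
def HOnlyBist (V : Euc n → ℝ) : Prop :=
  ∀ mp ∈ MinSet V, ∀ um : Euc n, gradient V um = 0 →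
    ∀ c > (0:ℝ), (Phi V c um mp).Nonempty → um ∈ MinSet V

/-- The set of invading speeds has empty interior. -/
def HDiscVel (V : Euc n → ℝ) : Prop :=
  ∀ mp ∈ MinSet V, interior {c : ℝ | 0 ≤ c ∧ (PhiInv V c mp).Nonempty} = ∅

/-- The set of initial values of normalized invading fronts is totally disconnected. -/
def HDiscFront (V : Euc n → ℝ) (dEsc : ℝ) : Prop :=
  ∀ mp ∈ MinSet V, ∀ c > (0:ℝ),
    IsTotallyDisconnected
      {p : Euc n × Euc n | ∃ φ ∈ PhiNormInv V dEsc c mp, p = (φ 0, deriv φ 0)}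

/-- The generic hypotheses on the potential. -/
def HGen (V : Euc n → ℝ) (dEsc : ℝ) : Prop :=
  HNonDeg V ∧ HOnlyBist V ∧ HDiscVel V ∧ HDiscFront V dEsc

/-- The solution is stable at infinity, close to the minimum point `m`. -/
def StableAtInfinity (V : Euc n → ℝ) (u : ℝ → ℝ → Euc n) (m : Euc n) : Prop :=
  m ∈ MinSet V ∧
    Tendsto (fun t => limsup (fun r => ‖u r t - m‖) atTop) atTop (𝓝 0)

/-- Propagating terrace of bistable fronts connecting `mLoc` to `mFar`. -/
def IsTerrace (V : Euc n → ℝ) (mLoc mFar : Euc n) (T : ℝ → ℝ → Euc n) : Prop :=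
  ∃ (q : ℕ) (ms : ℕ → Euc n) (cs : ℕ → ℝ) (φs : ℕ → ℝ → Euc n) (rs : ℕ → ℝ → ℝ),
    ms 0 = mFar ∧ ms q = mLoc ∧ (∀ i, i ≤ q → ms i ∈ MinSet V) ∧
    (∀ i, i < q → V (ms (i + 1)) < V (ms i)) ∧
    (∀ i, 1 ≤ i → i ≤ q → 0 < cs i) ∧
    (∀ i, 1 ≤ i → i + 1 ≤ q → cs (i + 1) ≤ cs i) ∧
    (∀ i, 1 ≤ i → i ≤ q → φs i ∈ Phi V (cs i) (ms i) (ms (i - 1))) ∧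
    (∀ i, 1 ≤ i → i ≤ q →
      (∀ t : ℝ, 0 ≤ t → 0 ≤ rs i t) ∧ (∀ t : ℝ, DifferentiableAt ℝ (rs i) t) ∧
        Tendsto (deriv (rs i)) atTop (𝓝 (cs i))) ∧
    (∀ i, 1 ≤ i → i + 1 ≤ q → Tendsto (fun t => rs (i + 1) t - rs i t) atTop atTop) ∧
    (∀ r t : ℝ, 0 ≤ r → 0 ≤ t →
      T r t = ms 0 + ∑ i ∈ Finset.Icc 1 q, (φs i (r - rs i t) - ms (i - 1)))

/-- Hypothesis `(H_hom)` unbundled: `u` is close to `m` on a growing interval around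
`rHom t`, travelling at asymptotic speed `cHom`; closeness is measured in `H¹` norm. -/
def HHomWith (u : ℝ → ℝ → Euc n) (m : Euc n) (cHom : ℝ) (rHom : ℝ → ℝ) : Prop :=
  0 < cHom ∧ (∀ t : ℝ, DifferentiableAt ℝ rHom t) ∧
    Tendsto (deriv rHom) atTop (𝓝 cHom) ∧
    ∀ L > (0:ℝ),
      Tendsto
        (fun t => ∫ r in (-L)..L,
          (‖u (rHom t + r) t - m‖ ^ 2 + ‖ur u (rHom t + r) t‖ ^ 2))
        atTop (𝓝 0)

/-- The set whose supremum defines the Escape point `r_Esc(t)`. -/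
def rEscSet (u : ℝ → ℝ → Euc n) (m : Euc n) (dEsc : ℝ) (rHom : ℝ → ℝ) (t : ℝ) : Set ℝ :=
  {r | r ∈ Icc 0 (rHom t) ∧ ‖u r t - m‖ = dEsc}

/-- The Escape point `r_Esc(t)`. -/
def rEscF (u : ℝ → ℝ → Euc n) (m : Euc n) (dEsc : ℝ) (rHom : ℝ → ℝ) (t : ℝ) : ℝ :=
  sSup (rEscSet u m dEsc rHom t)

/-- The upper limit mean speed `c_Esc` of the Escape point. -/
def cEscV (u : ℝ → ℝ → Euc n) (m : Euc n) (dEsc : ℝ) (rHom : ℝ → ℝ) : ℝ :=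
  limsup (fun t => rEscF u m dEsc rHom t / t) atTop

/-- `q_hull`: minimal convexity of the lower quadratic hulls of `V` at minimum points. -/
def qHull (V : Euc n → ℝ) : ℝ :=
  sInf {q : ℝ | ∃ m ∈ MinSet V, ∃ x : Euc n, x ≠ m ∧ q = (V x - V m) / ‖x - m‖ ^ 2}

/-- The weight `w` of the energy in the firewall functionals. -/
def wV (V : Euc n → ℝ) : ℝ := 1 / max 1 (-(4 * qHull V))

/-- The decay rate `κ₀`. -/
def kappa0 (lmin : ℝ) : ℝ := min (1 / 2) (lmin / 8)

/-- The "small curvature" radius `r_sc`. -/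
def rsc (d : ℕ) (lmin : ℝ) : ℝ := max (2 * ((d : ℝ) - 1)) (8 * ((d : ℝ) - 1) / lmin)

/-- The weight function `T_ρ ψ₀`. -/
def Tpsi (d : ℕ) (lmin : ℝ) (ρ r : ℝ) : ℝ :=
  if r ≤ rsc d lmin then Real.exp (-(kappa0 lmin) * |r - ρ|) * (r / rsc d lmin) ^ (d - 1)
  else Real.exp (-(kappa0 lmin) * |r - ρ|)

/-- The firewall functional `F₀` in the laboratory frame. -/
def F0 (V : Euc n → ℝ) (d : ℕ) (lmin : ℝ) (u : ℝ → ℝ → Euc n) (ρ t : ℝ) : ℝ :=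
  ∫ r in Ioi (0:ℝ),
    Tpsi d lmin ρ r * (wV V * (‖ur u r t‖ ^ 2 / 2 + V (u r t)) + ‖u r t‖ ^ 2 / 2)

/-- The set `Σ₀(t)` where the solution Escapes at distance `dEsc` from the origin. -/
def Sigma0 (u : ℝ → ℝ → Euc n) (dEsc t : ℝ) : Set ℝ := {r | 0 ≤ r ∧ dEsc < ‖u r t‖}

/-- The firewall differential inequality in the laboratory frame. -/
def FireIneq (V : Euc n → ℝ) (d : ℕ) (lmin dEsc : ℝ) (u : ℝ → ℝ → Euc n) (ν K : ℝ) : Prop :=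
  ∀ ρ ≥ rsc d lmin, ∀ t > (0:ℝ),
    DifferentiableAt ℝ (fun s => F0 V d lmin u ρ s) t ∧
    deriv (fun s => F0 V d lmin u ρ s) t ≤
      -ν * F0 V d lmin u ρ t + K * ∫ r in Sigma0 u dEsc t, Tpsi d lmin ρ r

/-- The quantity `δ = d_Esc √(min(w/2,1/4)/(κ₀+1))`. -/
def deltaEsc (dEsc w κ₀ : ℝ) : ℝ := dEsc * Real.sqrt (min (w / 2) (1 / 4) / (κ₀ + 1))

/-- The length `L₀`. -/
def L0c (κ₀ ν K δ : ℝ) : ℝ := κ₀⁻¹ * Real.log (16 * K / (ν * δ ^ 2 * κ₀))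

/-- The no-escape speed `c_noesc`. -/
def cNoEsc (κ₀ K L₀ δ : ℝ) : ℝ := 8 * K * L₀ / (κ₀ * δ ^ 2)

/-- The no-escape hull `h`. -/
def hull (δ L₀ : ℝ) (x : ℝ) : EReal :=
  if x < 0 then ⊤
  else if x ≤ L₀ then ((δ ^ 2 / 2 * (1 - x / (2 * L₀)) : ℝ) : EReal)
  else ((δ ^ 2 / 4 : ℝ) : EReal)

/-- The standing hypothesis that the firewall is below the two mirror hulls positioned
around `rHom t`. -/
def HullBound (V : Euc n → ℝ) (d : ℕ) (lmin : ℝ) (u : ℝ → ℝ → Euc n) (δ L₀ : ℝ)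
    (rHom : ℝ → ℝ) : Prop :=
  ∀ t ≥ (0:ℝ), rsc d lmin ≤ rHom t - 1 ∧
    ∀ r ≥ rsc d lmin, ((F0 V d lmin u r t : ℝ) : EReal) ≤
      max (hull δ L₀ (r - (rHom t - 1))) (hull δ L₀ (rHom t - r))

/-- The set whose infimum defines the escape point `r_esc(t)`. -/
def rescSet (V : Euc n → ℝ) (d : ℕ) (lmin : ℝ) (u : ℝ → ℝ → Euc n) (δ L₀ : ℝ)
    (rHom : ℝ → ℝ) (t : ℝ) : Set ℝ :=
  {rl | rl ∈ Icc (rsc d lmin) (rHom t) ∧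
    ∀ r ≥ rsc d lmin, ((F0 V d lmin u r t : ℝ) : EReal) ≤
      max (hull δ L₀ (r - rl)) (hull δ L₀ (rHom t - r))}

/-- The escape point `r_esc(t)`. -/
def rescF (V : Euc n → ℝ) (d : ℕ) (lmin : ℝ) (u : ℝ → ℝ → Euc n) (δ L₀ : ℝ)
    (rHom : ℝ → ℝ) (t : ℝ) : ℝ :=
  sInf (rescSet V d lmin u δ L₀ rHom t)

/-- `c̄`: upper limit of mean variations of a function over time intervals of length `s`. -/
def cbarF (f : ℝ → ℝ) : ℝ :=
  limsup (fun s => sSup {x : ℝ | ∃ t ≥ (0:ℝ), x = f (t + s) - f t} / s) atTop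

/-- `c̲`: lower limit of mean variations of a function over time intervals of length `s`. -/
def cunderF (f : ℝ → ℝ) : ℝ :=
  liminf (fun s => sInf {x : ℝ | ∃ t ≥ (0:ℝ), x = f (t + s) - f t} / s) atTop

/-- The decay rate `κ` in the travelling frame. -/
def kappaTF (lmin cno : ℝ) : ℝ := min (1 / 4) (lmin / (16 * (cno + 1)))

/-- The cut-off speed `c_cut` in the travelling frame. -/
def ccutTF (lmin lmax cno : ℝ) : ℝ := min (lmin / (8 * lmax)) (lmin / (8 * (cno + 1)))

/-- The energy weight `w'` in the travelling frame. -/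
def wTF (V : Euc n → ℝ) (cno : ℝ) : ℝ := min (wV V) (1 / (cno + 1) ^ 2)

/-- The weight function `χ` of the localized energy in the travelling frame. -/
def chiTF (d : ℕ) (lmin lmax cno c xcut r0 : ℝ) (ρ s : ℝ) : ℝ :=
  if ρ ≤ -r0 - c * s + rsc d lmin then
    Real.exp (c * ρ) * ((r0 + c * s + ρ) / rsc d lmin) ^ (d - 1)
  else if ρ ≤ xcut + ccutTF lmin lmax cno * s then Real.exp (c * ρ)
  else
    Real.exp ((c + kappaTF lmin cno) * (xcut + ccutTF lmin lmax cno * s) -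
      kappaTF lmin cno * ρ)

/-- The weight function `ψ` of the firewall in the travelling frame. -/
def psiTF (d : ℕ) (lmin lmax cno c xcut r0 : ℝ) (ρ s : ℝ) : ℝ :=
  if ρ ≤ -r0 - c * s + rsc d lmin then
    Real.exp ((c + kappaTF lmin cno) * ρ -
        kappaTF lmin cno * (xcut + ccutTF lmin lmax cno * s)) *
      ((r0 + c * s + ρ) / rsc d lmin) ^ (d - 1)
  else if ρ ≤ xcut + ccutTF lmin lmax cno * s then
    Real.exp ((c + kappaTF lmin cno) * ρ -
      kappaTF lmin cno * (xcut + ccutTF lmin lmax cno * s))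
  else
    Real.exp ((c + kappaTF lmin cno) * (xcut + ccutTF lmin lmax cno * s) -
      kappaTF lmin cno * ρ)

/-- The firewall functional `F(s)` in the travelling frame. -/
def FTF (V : Euc n → ℝ) (d : ℕ) (lmin lmax cno : ℝ) (u : ℝ → ℝ → Euc n)
    (t0 c xcut r0 : ℝ) (s : ℝ) : ℝ :=
  ∫ ρ in Ioi (-r0 - c * s),
    psiTF d lmin lmax cno c xcut r0 ρ s *
      (wTF V cno *
          (‖ur u (r0 + c * s + ρ) (t0 + s)‖ ^ 2 / 2 + V (u (r0 + c * s + ρ) (t0 + s))) +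
        ‖u (r0 + c * s + ρ) (t0 + s)‖ ^ 2 / 2)

/-- The set `Σ(s)` where the solution Escapes, in the travelling frame. -/
def SigmaTF (u : ℝ → ℝ → Euc n) (d : ℕ) (lmin dEsc : ℝ) (t0 c r0 : ℝ) (s : ℝ) : Set ℝ :=
  {ρ | -r0 - c * s + rsc d lmin ≤ ρ ∧ dEsc < ‖u (r0 + c * s + ρ) (t0 + s)‖}

/-- The weight function `ψ̃` in the standing frame. -/
def psiSF (d : ℕ) (κ cm cp : ℝ) (r t : ℝ) : ℝ :=
  if r ≤ cm * t then r ^ (d - 1) * Real.exp (-κ * (cm * t - r))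
  else if r ≤ cp * t then r ^ (d - 1)
  else r ^ (d - 1) * Real.exp (-κ * (r - cp * t))

/-- The firewall functional `F̃` in the standing frame. -/
def FSF (V : Euc n → ℝ) (d : ℕ) (κ cm cp : ℝ) (u : ℝ → ℝ → Euc n) (t : ℝ) : ℝ :=
  ∫ r in Ioi (0:ℝ),
    psiSF d κ cm cp r t * (wV V * (‖ur u r t‖ ^ 2 / 2 + V (u r t)) + ‖u r t‖ ^ 2 / 2)

/-- The quantity `δ_dissip(t)` measuring the dissipation around the escape point. -/
def deltaDissip (u : ℝ → ℝ → Euc n) (re : ℝ → ℝ) (cesc : ℝ) (t : ℝ) : ℝ :=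
  sInf {ε : ℝ | 0 < ε ∧
    (∫ τ in (-1:ℝ)..1, ∫ ρ in (-(1/ε))..(1/ε),
      ‖ut u (re (t + τ) + ρ) (t + τ) + cesc • ur u (re (t + τ) + ρ) (t + τ)‖ ^ 2) ≤ ε}

/-- `u` solves the radially symmetric system with initial datum `u₀`, in the sense of the
semi-flow on bounded continuous functions (classical for positive times). -/
def SolvesWithInit (d : ℕ) (V : Euc n → ℝ) (u : ℝ → ℝ → Euc n) (u₀ : ℝ → Euc n) : Prop :=
  (∀ r : ℝ, 0 ≤ r → u r 0 = u₀ r) ∧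
  (∀ t : ℝ, 0 ≤ t → ContinuousOn (fun r => u r t) (Ici 0) ∧ ∃ C, ∀ r : ℝ, 0 ≤ r → ‖u r t‖ ≤ C) ∧
  (∀ t : ℝ, 0 ≤ t → ∀ ε > (0:ℝ), ∃ δ > (0:ℝ), ∀ t' : ℝ, 0 ≤ t' → |t' - t| ≤ δ →
    ∀ r : ℝ, 0 ≤ r → ‖u r t' - u r t‖ ≤ ε) ∧
  (∀ t > (0:ℝ), ∀ r > (0:ℝ),
    DifferentiableAt ℝ (fun s => u s t) r ∧ DifferentiableAt ℝ (fun s => ur u s t) r) ∧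
  (∀ t > (0:ℝ), ∀ r : ℝ, 0 ≤ r → DifferentiableAt ℝ (fun s => u r s) t) ∧
  (∀ t > (0:ℝ), ∀ r > (0:ℝ),
    ut u r t = -gradient V (u r t) + (((d : ℝ) - 1) / r) • ur u r t + urr u r t) ∧
  (∀ t > (0:ℝ), DifferentiableAt ℝ (fun s => u s t) 0 ∧ ur u 0 t = 0)

/-- The inverse square of a shifted variable is integrable away from its singularity. -/
theorem integrableOn_Ici_inv_sq_shift (p : ℝ) {b : ℝ} (hb : 0 < b) :
    IntegrableOn (fun x : ℝ => ((p + x) ^ 2)⁻¹) (Ici (b - p)) ∧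
      ∫ x in Ici (b - p), ((p + x) ^ 2)⁻¹ = b⁻¹ := by
  have hderiv : ∀ x ∈ Ici (b - p), HasDerivAt (fun x : ℝ => -(p + x)⁻¹) ((p + x) ^ 2)⁻¹ x := by
    intro x hx
    have hx' : p + x ≠ 0 := by
      have : b - p ≤ x := hx
      linarith
    exact (((hasDerivAt_id' x).const_add p).fun_inv hx').fun_neg.congr_deriv (by simp [neg_div])
  have hnonneg : ∀ x ∈ Ioi (b - p), 0 ≤ ((p + x) ^ 2)⁻¹ := fun x _ => by positivity
  have hlim : Tendsto (fun x : ℝ => -(p + x)⁻¹) atTop (𝓝 0) := by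
    simpa using (tendsto_inv_atTop_zero.comp (tendsto_atTop_add_const_left atTop p tendsto_id)).neg
  refine ⟨(integrableOn_Ici_iff_integrableOn_Ioi).2
    (integrableOn_Ioi_deriv_of_nonneg' hderiv hnonneg hlim), ?_⟩
  rw [integral_Ici_eq_integral_Ioi, integral_Ioi_of_hasDerivAt_of_nonneg' hderiv hnonneg hlim]
  simp

/-- An exponential weight against an inverse square, cut at an intermediate radius `R`. -/
theorem setIntegral_le_of_le_exp_mul_inv_sq {f : ℝ → ℝ} {A c p a R X : ℝ} (hA : 0 ≤ A)
    (hc : 0 ≤ c) (ha : 1 ≤ a) (hR : 0 < R)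
    (hf0 : ∀ x ∈ Icc (a - p) X, 0 ≤ f x)
    (hf : ∀ x ∈ Icc (a - p) X, f x ≤ A * (Real.exp (c * x) * ((p + x) ^ 2)⁻¹)) :
    ∫ x in Icc (a - p) X, f x ≤ A * (Real.exp (c * (R - p)) + R⁻¹ * Real.exp (c * X)) := by
  have ha0 : 0 < a := by linarith
  have key : ∀ b : ℝ, 0 < b →
      Integrable ((Ici (b - p)).indicator fun x : ℝ => ((p + x) ^ 2)⁻¹) ∧
      ∫ x in Icc (a - p) X, (Ici (b - p)).indicator (fun x : ℝ => ((p + x) ^ 2)⁻¹) x ≤ b⁻¹ := by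
    intro b hb
    obtain ⟨hi, he⟩ := integrableOn_Ici_inv_sq_shift p hb
    have hi' := hi.integrable_indicator measurableSet_Ici
    refine ⟨hi', ?_⟩
    rw [← he, ← integral_indicator measurableSet_Ici]
    exact setIntegral_le_integral hi'
      (Eventually.of_forall fun x => indicator_nonneg (fun y _ => by positivity) x)
  obtain ⟨ia, ea⟩ := key a ha0
  obtain ⟨iR, eR⟩ := key R hR
  have ia' := (ia.restrict (s := Icc (a - p) X)).const_mul (Real.exp (c * (R - p)))
  have iR' := (iR.restrict (s := Icc (a - p) X)).const_mul (Real.exp (c * X))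
  calc ∫ x in Icc (a - p) X, f x
      ≤ ∫ x in Icc (a - p) X, A *
          (Real.exp (c * (R - p)) * (Ici (a - p)).indicator (fun x : ℝ => ((p + x) ^ 2)⁻¹) x +
            Real.exp (c * X) * (Ici (R - p)).indicator (fun x : ℝ => ((p + x) ^ 2)⁻¹) x) := by
        refine integral_mono_of_nonneg ?_ ((ia'.add iR').const_mul A) ?_
        · exact (ae_restrict_iff' measurableSet_Icc).2 (Eventually.of_forall hf0)
        · refine (ae_restrict_iff' measurableSet_Icc).2 (Eventually.of_forall fun x hx => ?_)
          refine (hf x hx).trans (mul_le_mul_of_nonneg_left ?_ hA)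
          have hq : 0 ≤ ((p + x) ^ 2)⁻¹ := by positivity
          rw [indicator_of_mem (show x ∈ Ici (a - p) from hx.1)]
          by_cases hxR : x ∈ Ici (R - p)
          · rw [indicator_of_mem hxR]
            have : Real.exp (c * x) ≤ Real.exp (c * X) :=
              Real.exp_le_exp.2 (mul_le_mul_of_nonneg_left hx.2 hc)
            nlinarith [mul_le_mul_of_nonneg_right this hq,
              mul_nonneg (Real.exp_pos (c * (R - p))).le hq]
          · rw [indicator_of_notMem hxR]
            have hlt : x < R - p := not_le.1 hxR
            have : Real.exp (c * x) ≤ Real.exp (c * (R - p)) :=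
              Real.exp_le_exp.2 (mul_le_mul_of_nonneg_left hlt.le hc)
            simpa using mul_le_mul_of_nonneg_right this hq
    _ = A * (Real.exp (c * (R - p)) *
            (∫ x in Icc (a - p) X, (Ici (a - p)).indicator (fun x : ℝ => ((p + x) ^ 2)⁻¹) x) +
          Real.exp (c * X) *
            ∫ x in Icc (a - p) X, (Ici (R - p)).indicator (fun x : ℝ => ((p + x) ^ 2)⁻¹) x) := by
        rw [integral_const_mul, integral_add ia' iR', integral_const_mul, integral_const_mul]
    _ ≤ A * (Real.exp (c * (R - p)) + R⁻¹ * Real.exp (c * X)) := by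
        refine mul_le_mul_of_nonneg_left (add_le_add ?_ ?_) hA
        · exact mul_le_of_le_one_right (Real.exp_pos _).le (ea.trans (inv_le_one_of_one_le₀ ha))
        · rw [mul_comm]
          exact mul_le_mul_of_nonneg_right eR (Real.exp_pos _).le

/-- On the main interval the weight `χ` is the plain exponential. -/
theorem chiTF_eq_exp_of_mem_Icc {d : ℕ} {lmin lmax cno c xcut r0 ρ s : ℝ}
    (hrsc : rsc d lmin ≠ 0)
    (hρ : ρ ∈ Icc (-r0 - c * s + rsc d lmin) (xcut + ccutTF lmin lmax cno * s)) :
    chiTF d lmin lmax cno c xcut r0 ρ s = Real.exp (c * ρ) := by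
  unfold chiTF
  split_ifs with h₁ h₂
  · have : r0 + c * s + ρ = rsc d lmin := by linarith [le_antisymm h₁ hρ.1]
    rw [this, div_self hrsc, one_pow, mul_one]
  · rfl
  · exact absurd hρ.2 h₂

/-- upper bound for the curvature term on `I_main`. -/
theorem stmt8 {n d k : ℕ} (hn : 1 ≤ n) (hd : 2 ≤ d) (hk : 2 ≤ k)
    (V : Euc n → ℝ) (hV : ContDiff ℝ (k : ℕ∞) V) (hcoerc : HCoerc V)
    (D : EscData n V) (h0 : (0 : Euc n) ∈ MinSet V) (hV0 : V 0 = 0)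
    (cno : ℝ) (hcno : 0 < cno)
    (u : ℝ → ℝ → Euc n) (hu : IsRadialSolution d V u)
    (B : ℝ) (hB : ∀ r t : ℝ, 0 ≤ r → 0 ≤ t → ‖ur u r t‖ ^ 2 / 2 ≤ B)
    (t0 c xcut r0 : ℝ) (ht0 : 0 ≤ t0) (hc : 0 < c) (hc' : c ≤ cno) (hx : 0 ≤ xcut)
    (hr0 : 2 * rsc d D.lmin ≤ r0) :
    ∀ s ≥ (0:ℝ),
      (∫ ρ in Icc (-r0 - c * s + rsc d D.lmin) (xcut + ccutTF D.lmin D.lmax cno * s),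
        chiTF d D.lmin D.lmax cno c xcut r0 ρ s *
          (((d : ℝ) - 1) / (r0 + c * s + ρ)) ^ 2 *
          (‖ur u (r0 + c * s + ρ) (t0 + s)‖ ^ 2 / 2))
        ≤ B * ((d : ℝ) - 1) ^ 2 *
          (Real.exp (-c * r0 / 2) +
            2 / r0 * Real.exp (c * (xcut + ccutTF D.lmin D.lmax cno * s))) := by
  intro s hs
  have hd' : (2 : ℝ) ≤ d := by exact_mod_cast hd
  have hrsc : 1 ≤ rsc d D.lmin :=
    le_trans (by linarith) (le_max_left (2 * ((d : ℝ) - 1)) (8 * ((d : ℝ) - 1) / D.lmin))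
  have hr0' : 0 < r0 := by linarith
  have hB0 : 0 ≤ B := le_trans (by positivity) (hB 0 0 le_rfl le_rfl)
  have hcs : 0 ≤ c * s := mul_nonneg hc.le hs
  have hleft : -r0 - c * s + rsc d D.lmin = rsc d D.lmin - (r0 + c * s) := by ring
  have hA : 0 ≤ B * ((d : ℝ) - 1) ^ 2 := by positivity
  have main := setIntegral_le_of_le_exp_mul_inv_sq
    (f := fun ρ => chiTF d D.lmin D.lmax cno c xcut r0 ρ s *
      (((d : ℝ) - 1) / (r0 + c * s + ρ)) ^ 2 *
      (‖ur u (r0 + c * s + ρ) (t0 + s)‖ ^ 2 / 2))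
    (p := r0 + c * s) (X := xcut + ccutTF D.lmin D.lmax cno * s)
    hA hc.le hrsc (half_pos hr0')
    (fun ρ hρ => by
      rw [← hleft] at hρ
      simp only [chiTF_eq_exp_of_mem_Icc (by linarith) hρ]
      positivity)
    (fun ρ hρ => by
      have hy : 0 ≤ r0 + c * s + ρ := by linarith [hρ.1]
      rw [← hleft] at hρ
      simp only [chiTF_eq_exp_of_mem_Icc (by linarith) hρ]
      calc _ ≤ Real.exp (c * ρ) * (((d : ℝ) - 1) / (r0 + c * s + ρ)) ^ 2 * B :=
            mul_le_mul_of_nonneg_left (hB _ _ hy (by linarith)) (by positivity)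
        _ = _ := by rw [div_pow, div_eq_mul_inv]; ring)
  rw [hleft]
  refine main.trans (mul_le_mul_of_nonneg_left (add_le_add ?_ (by rw [inv_div])) hA)
  exact Real.exp_le_exp.2 (by nlinarith [mul_nonneg hc.le hcs])
end
end

section
/- (Control on the residual integral over I_left.) In the travelling-frame setup, assume sup over r,t of |u(r,t)| ≤ R and sup over r,t of |u_r(r,t)| ≤ R' with R, R' < ∞. Define, for s ≥ 0, F_res(s) = ∫_{I_left(s)} ψ(ρ,s)·[ (c(d−1)/(r₀+cs+ρ))·( w'(|v_ρ|²/2 + V(v)) + |v|²/2 ) + ((d−1)/(r₀+cs+ρ))·(v·v_ρ) + ( (c+2κ)(d−1)/(r₀+cs+ρ) + (d−1)(d−2)/(r₀+cs+ρ)² )·|v|²/2 ] dρ. Then there exists a positive quantity K depending only on V, d, R and R' such that for every s ≥ 0, F_res(s) ≤ K e^{−c r₀}. -/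
open Filter Topology Set MeasureTheory

noncomputable section

local notation "⟪" x ", " y "⟫" => @inner ℝ _ _ x y

variable {n : ℕ}

/-- The upper spectral bound is positive in positive dimension. -/
theorem EscData.lmax_pos {n : ℕ} (hn : 1 ≤ n) {V : Euc n → ℝ} (D : EscData n V)
    (h0 : (0 : Euc n) ∈ MinSet V) : 0 < D.lmax := by
  have hv : ‖(EuclideanSpace.single (⟨0, hn⟩ : Fin n) (1 : ℝ) : Euc n)‖ = 1 := by simp
  have h := (D.lower 0 h0 (EuclideanSpace.single ⟨0, hn⟩ 1)).trans (D.upper 0 h0 _)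
  rw [hv] at h
  linarith [D.lmin_pos]

theorem rsc_pos {d : ℕ} (hd : 2 ≤ d) (lmin : ℝ) : 0 < rsc d lmin := by
  have : (2 : ℝ) ≤ d := by exact_mod_cast hd
  exact lt_max_of_lt_left (by linarith)

theorem kappaTF_nonneg {lmin cno : ℝ} (hl : 0 < lmin) (hc : 0 < cno) :
    0 ≤ kappaTF lmin cno :=
  le_min (by norm_num) (by positivity)

theorem ccutTF_nonneg {lmin lmax cno : ℝ} (hl : 0 < lmin) (hL : 0 < lmax) (hc : 0 < cno) :
    0 ≤ ccutTF lmin lmax cno :=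
  le_min (by positivity) (by positivity)

/-- The curvature weight compensates a simple pole at the origin. -/
theorem div_pow_div_le {d : ℕ} (hd : 2 ≤ d) {r a : ℝ} (hr : 0 ≤ r) (ha : 0 < a) (hra : r ≤ a) :
    (r / a) ^ (d - 1) / r ≤ 1 / a := by
  rcases hr.eq_or_lt with rfl | hr
  · simpa using ha.le
  · have h1 : (r / a) ^ (d - 1) ≤ r / a :=
      pow_le_of_le_one (by positivity) ((div_le_one ha).2 hra) (by omega)
    calc (r / a) ^ (d - 1) / r ≤ r / a / r := by gcongr
      _ = 1 / a := by field_simp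

/-- The curvature weight compensates a double pole at the origin, unless `d = 2`. -/
theorem sub_two_mul_div_pow_div_sq_le {d : ℕ} (hd : 2 ≤ d) {r a : ℝ} (hr : 0 ≤ r) (ha : 0 < a)
    (hra : r ≤ a) :
    ((d : ℝ) - 2) * ((r / a) ^ (d - 1) / r ^ 2) ≤ ((d : ℝ) - 2) * (1 / a ^ 2) := by
  rcases hd.eq_or_lt with rfl | hd
  · simp
  have hd2 : (0 : ℝ) ≤ (d : ℝ) - 2 := by
    have : (2 : ℝ) ≤ d := by exact_mod_cast hd.le
    linarith
  refine mul_le_mul_of_nonneg_left ?_ hd2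
  rcases hr.eq_or_lt with rfl | hr
  · simpa using sq_nonneg a
  · have h1 : (r / a) ^ (d - 1) ≤ (r / a) ^ 2 :=
      pow_le_pow_of_le_one (by positivity) ((div_le_one ha).2 hra) (by omega)
    calc (r / a) ^ (d - 1) / r ^ 2 ≤ (r / a) ^ 2 / r ^ 2 := by gcongr
      _ = 1 / a ^ 2 := by field_simp

/-- Pointwise bound on the weighted residual terms near the origin. -/
theorem abs_residual_le {d : ℕ} (hd : 2 ≤ d) {r a c cno κ X Y Z BX BY BZ : ℝ}
    (hr : 0 ≤ r) (ha : 0 < a) (hra : r ≤ a) (hc : 0 ≤ c) (hccno : c ≤ cno) (hκ : 0 ≤ κ)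
    (hX : |X| ≤ BX) (hY : |Y| ≤ BY) (hZ : |Z| ≤ BZ) :
    |(r / a) ^ (d - 1) *
        (c * ((d : ℝ) - 1) / r * X + ((d : ℝ) - 1) / r * Y +
          ((c + 2 * κ) * ((d : ℝ) - 1) / r + ((d : ℝ) - 1) * ((d : ℝ) - 2) / r ^ 2) * Z)| ≤
      cno * ((d : ℝ) - 1) * (1 / a) * BX + ((d : ℝ) - 1) * (1 / a) * BY +
        ((cno + 2 * κ) * ((d : ℝ) - 1) * (1 / a) +
          ((d : ℝ) - 1) * (((d : ℝ) - 2) * (1 / a ^ 2))) * BZ := by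
  have h2 : (2 : ℝ) ≤ d := by exact_mod_cast hd
  have hd1 : (0 : ℝ) ≤ (d : ℝ) - 1 := by linarith
  have hd2 : (0 : ℝ) ≤ (d : ℝ) - 2 := by linarith
  have hp1 := div_pow_div_le hd hr ha hra
  have hp2 := sub_two_mul_div_pow_div_sq_le hd hr ha hra
  have hq1 : 0 ≤ (r / a) ^ (d - 1) / r := by positivity
  have hq2 : 0 ≤ ((d : ℝ) - 2) * ((r / a) ^ (d - 1) / r ^ 2) := by positivity
  have hsplit : (r / a) ^ (d - 1) *
        (c * ((d : ℝ) - 1) / r * X + ((d : ℝ) - 1) / r * Y +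
          ((c + 2 * κ) * ((d : ℝ) - 1) / r + ((d : ℝ) - 1) * ((d : ℝ) - 2) / r ^ 2) * Z) =
      c * ((d : ℝ) - 1) * ((r / a) ^ (d - 1) / r) * X +
        ((d : ℝ) - 1) * ((r / a) ^ (d - 1) / r) * Y +
        ((c + 2 * κ) * ((d : ℝ) - 1) * ((r / a) ^ (d - 1) / r) +
          ((d : ℝ) - 1) * (((d : ℝ) - 2) * ((r / a) ^ (d - 1) / r ^ 2))) * Z := by
    ring
  rw [hsplit]
  generalize (r / a) ^ (d - 1) / r = p at *
  generalize ((d : ℝ) - 2) * ((r / a) ^ (d - 1) / r ^ 2) = q at *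
  have ha1 : 0 ≤ 1 / a := by positivity
  have hcno : 0 ≤ cno := hc.trans hccno
  refine (abs_add_three _ _ _).trans ?_
  rw [abs_mul _ X, abs_mul _ Y, abs_mul _ Z,
    abs_of_nonneg (show 0 ≤ c * ((d : ℝ) - 1) * p by positivity),
    abs_of_nonneg (show 0 ≤ ((d : ℝ) - 1) * p by positivity),
    abs_of_nonneg (show 0 ≤ (c + 2 * κ) * ((d : ℝ) - 1) * p + ((d : ℝ) - 1) * q by positivity)]
  gcongr

/-- On the left interval the exponential factor of `psiTF` is of order `exp (-c r₀)`. -/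
theorem exp_weight_le {c cno κ y r₀ a s ρ : ℝ} (hc : 0 ≤ c) (hccno : c ≤ cno) (hκ : 0 ≤ κ)
    (hy : 0 ≤ y) (ha : 0 ≤ a) (hr₀ : a ≤ r₀) (hs : 0 ≤ s) (hρ : ρ ≤ -r₀ - c * s + a) :
    Real.exp ((c + κ) * ρ - κ * y) ≤ Real.exp (cno * a) * Real.exp (-c * r₀) := by
  rw [← Real.exp_add]
  have hcs : 0 ≤ c * s := mul_nonneg hc hs
  have h1 : (c + κ) * ρ ≤ (c + κ) * (-r₀ - c * s + a) := by gcongr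
  have h2 : c * a ≤ cno * a := by gcongr
  have h3 : 0 ≤ κ * (r₀ + c * s - a) := mul_nonneg hκ (by linarith)
  have h4 : 0 ≤ κ * y := mul_nonneg hκ hy
  have h5 : 0 ≤ c * (c * s) := mul_nonneg hc hcs
  apply Real.exp_le_exp.2
  linarith

/-- control on the residual integral over `I_left`. -/
theorem stmt10 {n d k : ℕ} (hn : 1 ≤ n) (hd : 2 ≤ d) (hk : 2 ≤ k)
    (V : Euc n → ℝ) (hV : ContDiff ℝ (k : ℕ∞) V) (hcoerc : HCoerc V)
    (D : EscData n V) (h0 : (0 : Euc n) ∈ MinSet V) (hV0 : V 0 = 0)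
    (cno : ℝ) (hcno : 0 < cno) (R R' : ℝ) :
    ∃ K > (0:ℝ),
      ∀ u : ℝ → ℝ → Euc n, IsRadialSolution d V u →
        (∀ r t : ℝ, 0 ≤ r → 0 ≤ t → ‖u r t‖ ≤ R) →
        (∀ r t : ℝ, 0 ≤ r → 0 ≤ t → ‖ur u r t‖ ≤ R') →
        ∀ t0 c xcut r0 : ℝ, 0 ≤ t0 → 0 < c → c ≤ cno → 0 ≤ xcut →
          2 * rsc d D.lmin ≤ r0 →
          ∀ s ≥ (0:ℝ),
            (∫ ρ in Icc (-r0 - c * s) (-r0 - c * s + rsc d D.lmin),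
              psiTF d D.lmin D.lmax cno c xcut r0 ρ s *
                ((c * ((d : ℝ) - 1) / (r0 + c * s + ρ)) *
                    (wTF V cno *
                        (‖ur u (r0 + c * s + ρ) (t0 + s)‖ ^ 2 / 2 +
                          V (u (r0 + c * s + ρ) (t0 + s))) +
                      ‖u (r0 + c * s + ρ) (t0 + s)‖ ^ 2 / 2) +
                  (((d : ℝ) - 1) / (r0 + c * s + ρ)) *
                    ⟪u (r0 + c * s + ρ) (t0 + s), ur u (r0 + c * s + ρ) (t0 + s)⟫ +
                  ((c + 2 * kappaTF D.lmin cno) * ((d : ℝ) - 1) / (r0 + c * s + ρ) +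
                      ((d : ℝ) - 1) * ((d : ℝ) - 2) / (r0 + c * s + ρ) ^ 2) *
                    (‖u (r0 + c * s + ρ) (t0 + s)‖ ^ 2 / 2)))
              ≤ K * Real.exp (-c * r0) := by
  obtain ⟨M, hM⟩ := (isCompact_closedBall (0 : Euc n) R).exists_bound_of_continuousOn
    hV.continuous.continuousOn
  have ha := rsc_pos hd D.lmin
  have hκ := kappaTF_nonneg D.lmin_pos hcno
  have hcut := ccutTF_nonneg D.lmin_pos (D.lmax_pos hn h0) hcno
  set a := rsc d D.lmin
  set κ := kappaTF D.lmin cno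
  set B : ℝ := cno * ((d : ℝ) - 1) * (1 / a) * (|wTF V cno| * (R' ^ 2 / 2 + M) + R ^ 2 / 2) +
    ((d : ℝ) - 1) * (1 / a) * (R * R') +
    ((cno + 2 * κ) * ((d : ℝ) - 1) * (1 / a) +
      ((d : ℝ) - 1) * (((d : ℝ) - 2) * (1 / a ^ 2))) * (R ^ 2 / 2) with hB
  refine ⟨Real.exp (cno * a) * |B| * a + 1, by positivity, ?_⟩
  intro u _ hu hur t0 c xcut r0 ht0 hc hccno hxcut hr0 s hs
  have hbound : ∀ ρ ∈ Icc (-r0 - c * s) (-r0 - c * s + a),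
      ‖psiTF d D.lmin D.lmax cno c xcut r0 ρ s *
        ((c * ((d : ℝ) - 1) / (r0 + c * s + ρ)) *
            (wTF V cno *
                (‖ur u (r0 + c * s + ρ) (t0 + s)‖ ^ 2 / 2 +
                  V (u (r0 + c * s + ρ) (t0 + s))) +
              ‖u (r0 + c * s + ρ) (t0 + s)‖ ^ 2 / 2) +
          (((d : ℝ) - 1) / (r0 + c * s + ρ)) *
            ⟪u (r0 + c * s + ρ) (t0 + s), ur u (r0 + c * s + ρ) (t0 + s)⟫ +
          ((c + 2 * κ) * ((d : ℝ) - 1) / (r0 + c * s + ρ) +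
              ((d : ℝ) - 1) * ((d : ℝ) - 2) / (r0 + c * s + ρ) ^ 2) *
            (‖u (r0 + c * s + ρ) (t0 + s)‖ ^ 2 / 2))‖ ≤
        Real.exp (cno * a) * Real.exp (-c * r0) * |B| := by
    rintro ρ ⟨hρ, hρ'⟩
    have hr : 0 ≤ r0 + c * s + ρ := by linarith
    have hra : r0 + c * s + ρ ≤ a := by linarith
    have hu' := hu _ (t0 + s) hr (by linarith)
    have hur' := hur _ (t0 + s) hr (by linarith)
    have hVu := hM (u (r0 + c * s + ρ) (t0 + s)) (by simpa using hu')
    rw [Real.norm_eq_abs] at hVu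
    have hexp := exp_weight_le (y := xcut + ccutTF D.lmin D.lmax cno * s) hc.le hccno hκ
      (by positivity) ha.le (by linarith) hs hρ'
    rw [psiTF, if_pos hρ', mul_assoc, norm_mul, Real.norm_eq_abs, Real.norm_eq_abs, Real.abs_exp]
    generalize r0 + c * s + ρ = r at *
    generalize u r (t0 + s) = v at *
    generalize ur u r (t0 + s) = v' at *
    have hR : 0 ≤ R := (norm_nonneg _).trans hu'
    have hv : ‖v‖ ^ 2 ≤ R ^ 2 := by gcongr
    have hv' : ‖v'‖ ^ 2 ≤ R' ^ 2 := by gcongr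
    have hZ : |‖v‖ ^ 2 / 2| ≤ R ^ 2 / 2 := by
      rw [abs_of_nonneg (by positivity)]
      gcongr
    have hY : |⟪v, v'⟫| ≤ R * R' :=
      (abs_real_inner_le_norm v v').trans (by gcongr)
    have hE : |‖v'‖ ^ 2 / 2 + V v| ≤ R' ^ 2 / 2 + M := by
      refine (abs_add_le _ _).trans ?_
      rw [abs_of_nonneg (show 0 ≤ ‖v'‖ ^ 2 / 2 by positivity)]
      gcongr
    have hX : |wTF V cno * (‖v'‖ ^ 2 / 2 + V v) + ‖v‖ ^ 2 / 2| ≤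
        |wTF V cno| * (R' ^ 2 / 2 + M) + R ^ 2 / 2 := by
      refine (abs_add_le _ _).trans ?_
      rw [abs_mul]
      gcongr
    have hres := abs_residual_le hd hr ha hra hc.le hccno hκ hX hY hZ
    rw [← hB] at hres
    exact mul_le_mul hexp (hres.trans (le_abs_self B)) (abs_nonneg _) (by positivity)
  have hint := norm_setIntegral_le_of_norm_le_const (μ := volume) measure_Icc_lt_top hbound
  refine (le_abs_self _).trans (hint.trans ?_)
  rw [Real.volume_real_Icc_of_le (by linarith)]
  have := Real.exp_pos (-c * r0)
  linarith
end
end
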